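/- Let k be an algebraically closed field of characteristic 2 and n ≥ 2. The unipotent conjugacy class with Jordan type 4 ⊕ 1^{2n−4} (one Jordan block of size 4 and 2n−4 blocks of size 1) in Sp(2n, k) is not spherical. -/

import Mathlib

open scoped Matrix

section SphericalDefs

variable (G : Type*) [Group G] [TopologicalSpace G]

/-- A Borel subgroup of an algebraic group: a maximal closed connected solvable subgroup. -/
def IsBorel (B : Subgroup G) : Prop :=
  IsClosed (B : Set G) ∧ IsConnected (B : Set G) ∧ IsSolvable B ∧
    ∀ B' : Subgroup G, IsClosed (B' : Set G) → IsConnected (B' : Set G) → IsSolvable B' →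
      B ≤ B' → B' = B

variable {G}

/-- The orbit of `x` under conjugation by elements of a subgroup `B`. -/
def conjOrbit (B : Subgroup G) (x : G) : Set G := {g | ∃ b ∈ B, g = b * x * b⁻¹}

/-- The conjugacy class of `u`. -/
def conjClass (u : G) : Set G := {v | IsConj u v}

variable (G)

/-- A subset (typically a conjugacy class) of `G` is *spherical* if a Borel subgroup of `G`
has a dense orbit on it (acting by conjugation). -/
def IsSphericalClass (O : Set G) : Prop :=
  ∃ B : Subgroup G, IsBorel G B ∧ ∃ x ∈ O, O ⊆ closure (conjOrbit B x)

/-- A subgroup `H ≤ G` is a *spherical subgroup* if a Borel subgroup of `G` has a dense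
orbit on the homogeneous space `G ⧸ H`, i.e. `G ⧸ H` is a spherical homogeneous space. -/
def IsSphericalSubgroup (H : Subgroup G) : Prop :=
  ∃ B : Subgroup G, IsBorel G B ∧ ∃ x : G ⧸ H, Dense {y : G ⧸ H | ∃ b ∈ B, y = b • x}

end SphericalDefs

/-- The (classical) Zariski topology on the affine space `ι → k`:
a basis of open sets is given by the nonvanishing loci of polynomials. -/
def zariskiTopology (k : Type*) [CommRing k] (ι : Type*) : TopologicalSpace (ι → k) :=
  TopologicalSpace.generateFrom
    {s | ∃ p : MvPolynomial ι k, s = {v | MvPolynomial.eval v p ≠ 0}}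

/-- The Zariski topology on the general linear group `GL m k`, viewing it as an affine
variety via `g ↦ (g, g⁻¹)`. -/
instance glZariskiTopology (m k : Type*) [DecidableEq m] [Fintype m] [CommRing k] :
    TopologicalSpace (GL m k) :=
  TopologicalSpace.induced
    (fun g => Sum.elim (fun p : m × m => ((g : Matrix m m k)) p.1 p.2)
      (fun p : m × m => (((g⁻¹ : GL m k) : Matrix m m k)) p.1 p.2))
    (zariskiTopology k ((m × m) ⊕ (m × m)))

noncomputable section

variable (k : Type*) [Field k] (n : ℕ)

private lemma glInvVec {k : Type*} [Field k] {m : Type*} [DecidableEq m] [Fintype m]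
    (g : GL m k) (u : m → k) :
    (g : Matrix m m k) *ᵥ (((g⁻¹ : GL m k) : Matrix m m k) *ᵥ u) = u := by
  rw [Matrix.mulVec_mulVec, ← Units.val_mul, mul_inv_cancel, Units.val_one,
    Matrix.one_mulVec]

/-- The standard nondegenerate alternating bilinear form on `k^{2n}`. -/
def sympForm (v w : (Fin n ⊕ Fin n) → k) : k :=
  ∑ i : Fin n, (v (Sum.inl i) * w (Sum.inr i) - v (Sum.inr i) * w (Sum.inl i))

/-- The symplectic group `Sp(2n, k)`: the subgroup of `GL(2n, k)` preserving the
standard nondegenerate alternating bilinear form. -/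
def SpGroup : Subgroup (GL (Fin n ⊕ Fin n) k) where
  carrier := {g : GL (Fin n ⊕ Fin n) k | ∀ v w : (Fin n ⊕ Fin n) → k,
      sympForm k n ((g : Matrix (Fin n ⊕ Fin n) (Fin n ⊕ Fin n) k) *ᵥ v)
        ((g : Matrix (Fin n ⊕ Fin n) (Fin n ⊕ Fin n) k) *ᵥ w) = sympForm k n v w}
  mul_mem' := by
    intro a b ha hb v w
    simp only [Units.val_mul, ← Matrix.mulVec_mulVec]
    rw [ha, hb]
  one_mem' := by
    intro v w
    simp [Matrix.one_mulVec]
  inv_mem' := by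
    intro g hg v w
    conv_rhs => rw [← glInvVec g v, ← glInvVec g w, hg]

/-- A unipotent element of `Sp(2n, k)` has Jordan type `4 ⊕ 1^{2n-4}`: one Jordan block of
size 4 and `2n - 4` blocks of size 1.  This is equivalent to the stated rank conditions on
`N = u - 1`. -/
def hasJordanType4 {k : Type*} [Field k] {n : ℕ} (u : SpGroup k n) : Prop :=
  letI N : Matrix (Fin n ⊕ Fin n) (Fin n ⊕ Fin n) k :=
    ((u : GL (Fin n ⊕ Fin n) k) : Matrix (Fin n ⊕ Fin n) (Fin n ⊕ Fin n) k) - 1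
  N ^ 4 = 0 ∧ N.rank = 3 ∧ (N ^ 2).rank = 2 ∧ (N ^ 3).rank = 1

open scoped commutatorElement

section LieKolchin

variable {m k : Type*} [DecidableEq m] [Fintype m] [Field k]

/-- The algebra of regular functions on `GL m k`, generated by the entries of a matrix and of
its inverse. -/
def regularFunctions (m k : Type*) [DecidableEq m] [Fintype m] [Field k] :
    Subalgebra k (GL m k → k) :=
  Algebra.adjoin k
    (Set.range (fun (p : m × m) (g : GL m k) => (g : Matrix m m k) p.1 p.2) ∪
      Set.range (fun (p : m × m) (g : GL m k) => ((g⁻¹ : GL m k) : Matrix m m k) p.1 p.2))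

lemma entry_mem_regularFunctions (i j : m) :
    (fun g : GL m k => (g : Matrix m m k) i j) ∈ regularFunctions m k :=
  Algebra.subset_adjoin (Or.inl ⟨(i, j), rfl⟩)

lemma inv_entry_mem_regularFunctions (i j : m) :
    (fun g : GL m k => ((g⁻¹ : GL m k) : Matrix m m k) i j) ∈ regularFunctions m k :=
  Algebra.subset_adjoin (Or.inr ⟨(i, j), rfl⟩)

lemma const_mem_regularFunctions (c : k) :
    (fun _ : GL m k => c) ∈ regularFunctions m k :=
  (regularFunctions m k).algebraMap_mem c

/-- A regular function is the restriction of a polynomial in the entries of a matrix and of its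
inverse. -/
lemma exists_mvPolynomial_of_mem_regularFunctions {f : GL m k → k}
    (hf : f ∈ regularFunctions m k) :
    ∃ p : MvPolynomial ((m × m) ⊕ (m × m)) k, ∀ g : GL m k,
      f g = MvPolynomial.eval (Sum.elim (fun p : m × m => (g : Matrix m m k) p.1 p.2)
        (fun p : m × m => ((g⁻¹ : GL m k) : Matrix m m k) p.1 p.2)) p := by
  induction hf using Algebra.adjoin_induction with
  | mem f hf =>
    rcases hf with ⟨q, rfl⟩ | ⟨q, rfl⟩
    · exact ⟨MvPolynomial.X (Sum.inl q), fun g => by simp⟩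
    · exact ⟨MvPolynomial.X (Sum.inr q), fun g => by simp⟩
  | algebraMap c => exact ⟨MvPolynomial.C c, fun g => by simp⟩
  | add f₁ f₂ _ _ h₁ h₂ =>
    obtain ⟨p₁, h₁⟩ := h₁
    obtain ⟨p₂, h₂⟩ := h₂
    exact ⟨p₁ + p₂, fun g => by simp [h₁, h₂]⟩
  | mul f₁ f₂ _ _ h₁ h₂ =>
    obtain ⟨p₁, h₁⟩ := h₁
    obtain ⟨p₂, h₂⟩ := h₂
    exact ⟨p₁ * p₂, fun g => by simp [h₁, h₂]⟩

lemma isOpen_ne_zero_of_mem_regularFunctions {f : GL m k → k}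
    (hf : f ∈ regularFunctions m k) : IsOpen {g : GL m k | f g ≠ 0} := by
  obtain ⟨p, hp⟩ := exists_mvPolynomial_of_mem_regularFunctions hf
  let _ := zariskiTopology k ((m × m) ⊕ (m × m))
  refine isOpen_induced_iff.2 ⟨{v | MvPolynomial.eval v p ≠ 0},
    TopologicalSpace.isOpen_generateFrom_of_mem ⟨p, rfl⟩, ?_⟩
  ext g
  simp [hp]

/-- Regular functions are preserved by precomposition with a map whose matrix entries are
regular. -/
lemma comp_mem_regularFunctions {φ : GL m k → GL m k}
    (h₁ : ∀ i j, (fun g => (φ g : Matrix m m k) i j) ∈ regularFunctions m k)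
    (h₂ : ∀ i j, (fun g => (((φ g)⁻¹ : GL m k) : Matrix m m k) i j) ∈ regularFunctions m k)
    {f : GL m k → k} (hf : f ∈ regularFunctions m k) :
    (fun g => f (φ g)) ∈ regularFunctions m k := by
  induction hf using Algebra.adjoin_induction with
  | mem f hf =>
    rcases hf with ⟨q, rfl⟩ | ⟨q, rfl⟩
    · exact h₁ q.1 q.2
    · exact h₂ q.1 q.2
  | algebraMap c => exact const_mem_regularFunctions c
  | add f₁ f₂ _ _ h₁ h₂ => exact add_mem h₁ h₂
  | mul f₁ f₂ _ _ h₁ h₂ => exact mul_mem h₁ h₂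

/-- A matrix-valued map on `GL m k` all of whose entries are regular functions. -/
def HasRegularEntries (A : GL m k → Matrix m m k) : Prop :=
  ∀ i j, (fun g => A g i j) ∈ regularFunctions m k

lemma HasRegularEntries.mul {A B : GL m k → Matrix m m k} (hA : HasRegularEntries A)
    (hB : HasRegularEntries B) : HasRegularEntries (fun g => A g * B g) := by
  intro i j
  have : (fun g => (A g * B g) i j) = ∑ l, (fun g => A g i l) * (fun g => B g l j) := by
    ext g
    simp [Matrix.mul_apply]
  rw [this]
  exact sum_mem fun l _ => mul_mem (hA i l) (hB l j)

lemma hasRegularEntries_const (M : Matrix m m k) :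
    HasRegularEntries (fun _ : GL m k => M) :=
  fun i j => const_mem_regularFunctions (M i j)

lemma hasRegularEntries_id : HasRegularEntries (fun g : GL m k => (g : Matrix m m k)) :=
  entry_mem_regularFunctions

lemma hasRegularEntries_inv :
    HasRegularEntries (fun g : GL m k => ((g⁻¹ : GL m k) : Matrix m m k)) :=
  inv_entry_mem_regularFunctions

lemma HasRegularEntries.mulVec_apply_mem {A : GL m k → Matrix m m k} (hA : HasRegularEntries A)
    (v : m → k) (i : m) : (fun g => (A g *ᵥ v) i) ∈ regularFunctions m k := by
  have : (fun g => (A g *ᵥ v) i) = ∑ l, (fun g => A g i l) * (fun _ => v l) := by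
    ext g
    simp [Matrix.mulVec, dotProduct]
  rw [this]
  exact sum_mem fun l _ => mul_mem (hA i l) (const_mem_regularFunctions _)

/-- Every regular function taking finitely many values on `H` is constant on `H`. -/
def IsRegularlyConnected (H : Subgroup (GL m k)) : Prop :=
  ∀ f ∈ regularFunctions m k, (f '' (H : Set (GL m k))).Finite → ∀ h ∈ H, f h = f 1

lemma isRegularlyConnected_of_isPreconnected {H : Subgroup (GL m k)}
    (hH : IsPreconnected (H : Set (GL m k))) : IsRegularlyConnected H := by
  classical
  intro f hf hfin h hh
  by_contra hne
  set s := hfin.toFinset.erase (f 1) with hs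
  have hf₁ : (fun g => f g - f 1) ∈ regularFunctions m k :=
    sub_mem hf (const_mem_regularFunctions _)
  have hf₂ : (∏ c ∈ s, (fun g => f g - c)) ∈ regularFunctions m k :=
    prod_mem fun c _ => sub_mem hf (const_mem_regularFunctions c)
  obtain ⟨g, hg, hg₁, hg₂⟩ := hH _ _ (isOpen_ne_zero_of_mem_regularFunctions hf₁)
    (isOpen_ne_zero_of_mem_regularFunctions hf₂)
    (by
      intro g _
      by_cases hg : f g = f 1
      · right
        simp only [Set.mem_ofPred_eq, Finset.prod_apply, hg]
        refine Finset.prod_ne_zero_iff.2 fun c hc => ?_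
        exact sub_ne_zero.2 (Finset.ne_of_mem_erase hc).symm
      · left
        exact sub_ne_zero.2 hg)
    ⟨h, hh, sub_ne_zero.2 hne⟩
    ⟨1, H.one_mem, by
      simp only [Set.mem_ofPred_eq, Finset.prod_apply]
      refine Finset.prod_ne_zero_iff.2 fun c hc => ?_
      exact sub_ne_zero.2 (Finset.ne_of_mem_erase hc).symm⟩
  simp only [Set.mem_ofPred_eq, Finset.prod_apply] at hg₁ hg₂
  refine Finset.prod_ne_zero_iff.1 hg₂ (f g) ?_ (sub_self _)
  exact Finset.mem_erase.2 ⟨sub_ne_zero.1 hg₁, hfin.mem_toFinset.2 ⟨g, hg, rfl⟩⟩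

lemma IsRegularlyConnected.commutator {H : Subgroup (GL m k)} (hH : IsRegularlyConnected H) :
    IsRegularlyConnected ⁅H, H⁆ := by
  intro f hf hfin d hd
  suffices ∀ r ∈ ⁅H, H⁆, f (d * r) = f r by simpa using this 1 (one_mem _)
  rw [Subgroup.commutator_def] at hd
  induction hd using Subgroup.closure_induction with
  | mem d hd =>
    obtain ⟨a, ha, b, hb, rfl⟩ := hd
    intro r hr
    have hreg : (fun g : GL m k => f (⁅g, b⁆ * r)) ∈ regularFunctions m k := by
      refine comp_mem_regularFunctions ?_ ?_ hf
      · simp only [commutatorElement_def, Units.val_mul]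
        exact (((hasRegularEntries_id.mul (hasRegularEntries_const _)).mul
          hasRegularEntries_inv).mul (hasRegularEntries_const _)).mul (hasRegularEntries_const _)
      · simp only [commutatorElement_def, mul_inv_rev, inv_inv, Units.val_mul]
        exact (hasRegularEntries_const _).mul ((hasRegularEntries_const _).mul
          (hasRegularEntries_id.mul ((hasRegularEntries_const _).mul hasRegularEntries_inv)))
    have := hH _ hreg (hfin.subset (by
      rintro _ ⟨g, hg, rfl⟩
      exact ⟨_, mul_mem (Subgroup.commutator_mem_commutator hg hb) hr, rfl⟩)) a ha
    simpa using this
  | one => simp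
  | mul x y hx hy ihx ihy =>
    intro r hr
    rw [← Subgroup.commutator_def] at hy
    rw [mul_assoc, ihx _ (mul_mem hy hr), ihy r hr]
  | inv x hx ih =>
    intro r hr
    rw [← Subgroup.commutator_def] at hx
    rw [← ih _ (mul_mem (inv_mem hx) hr), mul_inv_cancel_left]

/-- A set of endomorphisms that stabilise a nonzero subspace and commute on it has a common
eigenvector in this subspace. -/
lemma exists_common_eigenvector_of_commute_on {V : Type*} [AddCommGroup V] [Module k V]
    [FiniteDimensional k V] [IsAlgClosed k] (S : Set (Module.End k V)) (d : ℕ) :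
    ∀ W : Submodule k V, Module.finrank k W = d → W ≠ ⊥ → (∀ s ∈ S, ∀ w ∈ W, s w ∈ W) →
      (∀ s ∈ S, ∀ t ∈ S, ∀ w ∈ W, s (t w) = t (s w)) →
      ∃ w ∈ W, w ≠ 0 ∧ ∀ s ∈ S, ∃ c : k, s w = c • w := by
  induction d using Nat.strong_induction_on with
  | _ d ih =>
  intro W hd hW hstab hcomm
  by_cases hscal : ∀ s ∈ S, ∃ c : k, ∀ w ∈ W, s w = c • w
  · obtain ⟨w, hw, hw0⟩ := W.ne_bot_iff.1 hW
    exact ⟨w, hw, hw0, fun s hs => (hscal s hs).imp fun c hc => hc w hw⟩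
  · push Not at hscal
    obtain ⟨s, hs, hns⟩ := hscal
    have : Nontrivial W := Submodule.nontrivial_iff_ne_bot.2 hW
    obtain ⟨μ, hμ⟩ := Module.End.exists_eigenvalue (s.restrict (hstab s hs))
    obtain ⟨w, hw⟩ := hμ.exists_hasEigenvector
    have hsw : s w = μ • (w : V) := by simpa using congrArg Subtype.val hw.apply_eq_smul
    have hmem : ∀ x, x ∈ W ⊓ Module.End.eigenspace s μ ↔ x ∈ W ∧ s x = μ • x := fun x => by
      rw [Submodule.mem_inf, Module.End.mem_eigenspace_iff]
    have hlt : W ⊓ Module.End.eigenspace s μ < W := by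
      refine lt_of_le_of_ne inf_le_left fun heq => ?_
      obtain ⟨x, hx, hne⟩ := hns μ
      rw [← heq] at hx
      exact hne ((hmem x).1 hx).2
    obtain ⟨x, hx, hx0, hxS⟩ := ih _ (hd ▸ Submodule.finrank_lt_finrank_of_lt hlt)
      (W ⊓ Module.End.eigenspace s μ) rfl
      ((Submodule.ne_bot_iff _).2 ⟨w, (hmem _).2 ⟨w.2, hsw⟩,
        fun h => hw.2 (Subtype.ext h)⟩)
      (fun t ht x hx => by
        rw [hmem] at hx ⊢
        exact ⟨hstab t ht x hx.1, by rw [hcomm s hs t ht x hx.1, hx.2, map_smul]⟩)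
      (fun t ht t' ht' x hx => hcomm t ht t' ht' x hx.1)
    exact ⟨x, hx.1, hx0, hxS⟩

lemma hasEigenvalue_mulVecLin {m k : Type*} [Fintype m] [Field k] {A : Matrix m m k}
    {v : m → k} {c : k} (hv : v ≠ 0) (h : A *ᵥ v = c • v) : Module.End.HasEigenvalue A.mulVecLin c :=
  Module.End.hasEigenvalue_of_hasEigenvector
    ⟨Module.End.mem_eigenspace_iff.2 (by simpa using h), hv⟩

lemma mulVec_inv_of_mulVec_eq_smul {g : GL m k} {v : m → k} {c : k} (hv : v ≠ 0)
    (h : (g : Matrix m m k) *ᵥ v = c • v) :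
    c ≠ 0 ∧ ((g⁻¹ : GL m k) : Matrix m m k) *ᵥ v = c⁻¹ • v := by
  have h1 : v = c • (((g⁻¹ : GL m k) : Matrix m m k) *ᵥ v) := by
    rw [← Matrix.mulVec_smul, ← h, Matrix.mulVec_mulVec, ← Units.val_mul, inv_mul_cancel,
      Units.val_one, Matrix.one_mulVec]
  have hc : c ≠ 0 := by
    rintro rfl
    exact hv (by rw [h1, zero_smul])
  refine ⟨hc, ?_⟩
  conv_rhs => rw [h1]
  rw [smul_smul, inv_mul_cancel₀ hc, one_smul]

/-- The Lie–Kolchin theorem: a connected solvable group of matrices over an algebraically closed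
field has a common eigenvector. -/
theorem exists_common_eigenvector_of_solvable [IsAlgClosed k] [Nonempty m] (n : ℕ) :
    ∀ H : Subgroup (GL m k), IsRegularlyConnected H →
      (fun K : Subgroup (GL m k) => ⁅K, K⁆)^[n] H = ⊥ →
      ∃ v : m → k, v ≠ 0 ∧ ∀ h ∈ H, ∃ c : k, (h : Matrix m m k) *ᵥ v = c • v := by
  induction n with
  | zero =>
    intro H _ hbot
    obtain ⟨v, hv⟩ := exists_ne (0 : m → k)
    refine ⟨v, hv, fun h hh => ⟨1, ?_⟩⟩
    rw [Function.iterate_zero, id] at hbot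
    rw [hbot, Subgroup.mem_bot] at hh
    simp [hh]
  | succ n ih =>
    intro H hH hbot
    obtain ⟨v, hv, hDv⟩ := ih ⁅H, H⁆ hH.commutator (by rwa [Function.iterate_succ_apply] at hbot)
    choose! χ hχ using hDv
    have hconj : ∀ h ∈ H, ∀ d ∈ ⁅H, H⁆, h⁻¹ * d * h ∈ ⁅H, H⁆ := fun h hh d hd => by
      have := mul_mem hd (Subgroup.commutator_mem_commutator (inv_mem
        (Subgroup.commutator_le_self H hd)) (inv_mem hh))
      simpa [commutatorElement_def, mul_assoc] using this
    obtain ⟨i, hi⟩ := Function.ne_iff.1 hv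
    have hχconj : ∀ d ∈ ⁅H, H⁆, ∀ h ∈ H, χ (h⁻¹ * d * h) = χ d := by
      intro d hd h hh
      have hreg : (fun g : GL m k => (((g⁻¹ * d * g : GL m k) : Matrix m m k) *ᵥ v) i) ∈
          regularFunctions m k := by
        refine HasRegularEntries.mulVec_apply_mem ?_ v i
        simp only [Units.val_mul]
        exact (hasRegularEntries_inv.mul (hasRegularEntries_const _)).mul hasRegularEntries_id
      have hfin := (Module.End.finite_hasEigenvalue (d : Matrix m m k).mulVecLin).image (fun c => c * v i)
      have := hH _ hreg (hfin.subset (by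
        rintro _ ⟨g, hg, rfl⟩
        refine ⟨χ (g⁻¹ * d * g), ?_, by simp only [hχ _ (hconj g hg d hd)]; rfl⟩
        refine hasEigenvalue_mulVecLin (v := (g : Matrix m m k) *ᵥ v) (fun h0 => hv ?_) ?_
        · have := congrArg (fun w => ((g⁻¹ : GL m k) : Matrix m m k) *ᵥ w) h0
          simpa [Matrix.mulVec_mulVec, ← Units.val_mul] using this
        · rw [← Matrix.mulVec_smul, ← hχ _ (hconj g hg d hd), Matrix.mulVec_mulVec,
            Matrix.mulVec_mulVec, ← Units.val_mul, ← Units.val_mul]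
          congr 2
          group)) h hh
      simp only [hχ _ (hconj h hh d hd), inv_one, one_mul, mul_one, hχ _ hd, Pi.smul_apply,
        smul_eq_mul] at this
      exact mul_right_cancel₀ hi this
    let W : Submodule k (m → k) :=
      { carrier := {w | ∀ d ∈ ⁅H, H⁆, (d : Matrix m m k) *ᵥ w = χ d • w}
        add_mem' := fun ha hb d hd => by rw [Matrix.mulVec_add, ha d hd, hb d hd, smul_add]
        zero_mem' := fun d _ => by simp
        smul_mem' := fun c w hw d hd => by rw [Matrix.mulVec_smul, hw d hd, smul_comm] }
    have hvW : v ∈ W := hχ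
    have hWstab : ∀ h ∈ H, ∀ w ∈ W, (h : Matrix m m k) *ᵥ w ∈ W := by
      intro h hh w hw d hd
      have := hw _ (hconj h hh d hd)
      rw [← hχconj d hd h hh, ← Matrix.mulVec_smul, ← this, Matrix.mulVec_mulVec,
        Matrix.mulVec_mulVec, ← Units.val_mul, ← Units.val_mul]
      congr 2
      group
    have hWne : W ≠ ⊥ := W.ne_bot_iff.2 ⟨v, hvW, hv⟩
    have hcomm : ∀ a ∈ H, ∀ b ∈ H, ∀ w ∈ W, (a : Matrix m m k) *ᵥ ((b : Matrix m m k) *ᵥ w) =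
        (b : Matrix m m k) *ᵥ ((a : Matrix m m k) *ᵥ w) := by
      intro a ha b hb w hw
      have hχ1 : χ ⁅a, b⁆ = 1 := by
        obtain ⟨x, hxW, hx, hbx⟩ := exists_common_eigenvector_of_commute_on
          {(b : Matrix m m k).mulVecLin} _ W rfl hWne
          (by rintro _ rfl w hw; exact hWstab b hb w hw) (by rintro _ rfl _ rfl w _; rfl)
        obtain ⟨μ, hμ⟩ := hbx _ rfl
        rw [Matrix.mulVecLin_apply] at hμ
        obtain ⟨hμ0, hμinv⟩ := mulVec_inv_of_mulVec_eq_smul hx hμ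
        obtain ⟨j, hj⟩ := Function.ne_iff.1 hx
        have hreg : (fun g : GL m k => ((⁅g, b⁆ : GL m k) : Matrix m m k).mulVec x j) ∈
            regularFunctions m k := by
          refine HasRegularEntries.mulVec_apply_mem ?_ x j
          simp only [commutatorElement_def, Units.val_mul]
          exact ((hasRegularEntries_id.mul (hasRegularEntries_const _)).mul
            hasRegularEntries_inv).mul (hasRegularEntries_const _)
        have hfin := (Module.End.finite_hasEigenvalue (b : Matrix m m k).mulVecLin).image
          (fun c => μ⁻¹ * c * x j)
        have := hH _ hreg (hfin.subset (by
          rintro _ ⟨g, hg, rfl⟩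
          have hgx := hxW _ (Subgroup.commutator_mem_commutator hg hb)
          refine ⟨μ * χ ⁅g, b⁆, ?_, by simp [hgx, hμ0]⟩
          refine hasEigenvalue_mulVecLin (v := ((g⁻¹ : GL m k) : Matrix m m k) *ᵥ x)
            (fun h0 => hx ?_) ?_
          · have := congrArg (fun w => (g : Matrix m m k) *ᵥ w) h0
            simpa [Matrix.mulVec_mulVec, ← Units.val_mul] using this
          · rw [← Matrix.mulVec_smul, mul_smul, ← hgx, ← Matrix.mulVec_smul, ← hμ,
              Matrix.mulVec_mulVec, Matrix.mulVec_mulVec, Matrix.mulVec_mulVec,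
              ← Units.val_mul, ← Units.val_mul, ← Units.val_mul, commutatorElement_def]
            congr 2
            group)) a ha
        simp only [hxW _ (Subgroup.commutator_mem_commutator ha hb), commutatorElement_one_left,
          Units.val_one, Matrix.one_mulVec, Pi.smul_apply, smul_eq_mul] at this
        exact mul_right_cancel₀ hj (this.trans (one_mul _).symm)
      have := hWstab b hb _ (hWstab a ha w hw) _ (Subgroup.commutator_mem_commutator ha hb)
      rw [hχ1, one_smul] at this
      rw [← this, Matrix.mulVec_mulVec, Matrix.mulVec_mulVec, Matrix.mulVec_mulVec,
        ← Units.val_mul, ← Units.val_mul, ← Units.val_mul, commutatorElement_def]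
      congr 2
      group
    obtain ⟨w, _, hw0, hw⟩ := exists_common_eigenvector_of_commute_on
      ((fun h : GL m k => (h : Matrix m m k).mulVecLin) '' H) _ W rfl hWne
      (by rintro _ ⟨h, hh, rfl⟩ w hw; exact hWstab h hh w hw)
      (by rintro _ ⟨a, ha, rfl⟩ _ ⟨b, hb, rfl⟩ w hw; exact hcomm a ha b hb w hw)
    exact ⟨w, hw0, fun h hh => hw _ ⟨h, hh, rfl⟩⟩

lemma map_subtype_derivedSeries {G : Type*} [Group G] (H : Subgroup G) (n : ℕ) :
    (derivedSeries H n).map H.subtype = (fun K : Subgroup G => ⁅K, K⁆)^[n] H := by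
  induction n with
  | zero => simp [← MonoidHom.range_eq_map]
  | succ n ih =>
    rw [derivedSeries_succ, Subgroup.map_commutator, ih, Function.iterate_succ_apply']

end LieKolchin

section Symplectic

variable {k : Type*} [Field k] {n : ℕ}

lemma sympForm_add_left (u v w : Fin n ⊕ Fin n → k) :
    sympForm k n (u + v) w = sympForm k n u w + sympForm k n v w := by
  simp only [sympForm, ← Finset.sum_add_distrib, Pi.add_apply]
  exact Finset.sum_congr rfl fun i _ => by ring

lemma sympForm_smul_left (c : k) (v w : Fin n ⊕ Fin n → k) :
    sympForm k n (c • v) w = c * sympForm k n v w := by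
  simp only [sympForm, Finset.mul_sum, Pi.smul_apply, smul_eq_mul]
  exact Finset.sum_congr rfl fun i _ => by ring

lemma sympForm_neg_swap (v w : Fin n ⊕ Fin n → k) :
    -sympForm k n v w = sympForm k n w v := by
  simp only [sympForm, ← Finset.sum_neg_distrib]
  exact Finset.sum_congr rfl fun i _ => by ring

lemma sympForm_self (v : Fin n ⊕ Fin n → k) : sympForm k n v v = 0 :=
  Finset.sum_eq_zero fun i _ => by ring

lemma sympForm_add_right (u v w : Fin n ⊕ Fin n → k) :
    sympForm k n u (v + w) = sympForm k n u v + sympForm k n u w := by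
  simp only [← sympForm_neg_swap _ u, sympForm_add_left, neg_add]

lemma sympForm_smul_right (c : k) (v w : Fin n ⊕ Fin n → k) :
    sympForm k n v (c • w) = c * sympForm k n v w := by
  simp only [← sympForm_neg_swap _ v, sympForm_smul_left, mul_neg]

lemma exists_sympForm_ne_zero {v : Fin n ⊕ Fin n → k} (hv : v ≠ 0) :
    ∃ w, sympForm k n v w ≠ 0 := by
  obtain ⟨i | i, hi⟩ := Function.ne_iff.1 hv
  · refine ⟨Pi.single (Sum.inr i) 1, ?_⟩
    simpa [sympForm, Pi.single_apply] using hi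
  · refine ⟨Pi.single (Sum.inl i) 1, ?_⟩
    simpa [sympForm, Pi.single_apply] using hi

/-- The symplectic transvection `v ↦ v + c ω(v, a) a`. -/
def sympTransvection (c : k) (a : Fin n ⊕ Fin n → k) :
    (Fin n ⊕ Fin n → k) →ₗ[k] (Fin n ⊕ Fin n → k) where
  toFun v := v + (c * sympForm k n v a) • a
  map_add' v w := by rw [sympForm_add_left]; module
  map_smul' r v := by rw [sympForm_smul_left, RingHom.id_apply]; module

lemma sympTransvection_apply (c : k) (a v : Fin n ⊕ Fin n → k) :
    sympTransvection c a v = v + (c * sympForm k n v a) • a := rfl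

lemma sympTransvection_comp_neg (c : k) (a : Fin n ⊕ Fin n → k) :
    sympTransvection c a ∘ₗ sympTransvection (-c) a = LinearMap.id := by
  refine LinearMap.ext fun v => ?_
  simp only [LinearMap.comp_apply, sympTransvection_apply, sympForm_add_left, sympForm_smul_left,
    sympForm_self, LinearMap.id_apply]
  module

lemma exists_spGroup_mulVec_eq_sympTransvection (c : k) (a : Fin n ⊕ Fin n → k) :
    ∃ g : SpGroup k n, ∀ v, (g : GL (Fin n ⊕ Fin n) k).val *ᵥ v = sympTransvection c a v := by
  let g : GL (Fin n ⊕ Fin n) k :=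
    ⟨LinearMap.toMatrix' (sympTransvection c a), LinearMap.toMatrix' (sympTransvection (-c) a),
      by rw [← LinearMap.toMatrix'_comp, sympTransvection_comp_neg, LinearMap.toMatrix'_id],
      by
        have := sympTransvection_comp_neg (-c) a
        rw [neg_neg] at this
        rw [← LinearMap.toMatrix'_comp, this, LinearMap.toMatrix'_id]⟩
  have hg : ∀ v, g.val *ᵥ v = sympTransvection c a v := LinearMap.toMatrix'_mulVec _
  refine ⟨⟨g, fun v w => ?_⟩, hg⟩
  simp only [hg, sympTransvection_apply, sympForm_add_left, sympForm_smul_left,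
    sympForm_add_right, sympForm_smul_right, sympForm_self, ← sympForm_neg_swap w a]
  ring

lemma exists_spGroup_mulVec_eq_of_sympForm_ne_zero {v w : Fin n ⊕ Fin n → k}
    (h : sympForm k n v w ≠ 0) :
    ∃ g : SpGroup k n, (g : GL (Fin n ⊕ Fin n) k).val *ᵥ v = w := by
  obtain ⟨g, hg⟩ := exists_spGroup_mulVec_eq_sympTransvection (sympForm k n v w)⁻¹
    (w + (-1 : k) • v)
  refine ⟨g, ?_⟩
  rw [hg, sympTransvection_apply, sympForm_add_right, sympForm_smul_right, sympForm_self, mul_zero,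
    add_zero, inv_mul_cancel₀ h]
  module

/-- The symplectic group acts transitively on nonzero vectors. -/
lemma exists_spGroup_mulVec_eq {v w : Fin n ⊕ Fin n → k} (hv : v ≠ 0) (hw : w ≠ 0) :
    ∃ g : SpGroup k n, (g : GL (Fin n ⊕ Fin n) k).val *ᵥ v = w := by
  obtain ⟨z, hvz, hzw⟩ : ∃ z, sympForm k n v z ≠ 0 ∧ sympForm k n z w ≠ 0 := by
    simp only [← sympForm_neg_swap w, neg_ne_zero]
    obtain ⟨y, hy⟩ := exists_sympForm_ne_zero hv
    obtain ⟨z, hz⟩ := exists_sympForm_ne_zero hw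
    by_cases hwy : sympForm k n w y = 0
    · by_cases hvz : sympForm k n v z = 0
      · exact ⟨y + z, by simp [sympForm_add_right, hvz, hy], by simp [sympForm_add_right, hwy, hz]⟩
      · exact ⟨z, hvz, hz⟩
    · exact ⟨y, hy, hwy⟩
  obtain ⟨g₁, h₁⟩ := exists_spGroup_mulVec_eq_of_sympForm_ne_zero hvz
  obtain ⟨g₂, h₂⟩ := exists_spGroup_mulVec_eq_of_sympForm_ne_zero hzw
  exact ⟨g₂ * g₁, by rw [Subgroup.coe_mul, Units.val_mul, ← Matrix.mulVec_mulVec, h₁, h₂]⟩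

lemma sympForm_swap [CharP k 2] (v w : Fin n ⊕ Fin n → k) :
    sympForm k n v w = sympForm k n w v := by
  rw [← sympForm_neg_swap, CharTwo.neg_eq]

lemma matrix_add_self_eq_zero {m : Type*} [CharP k 2] (M : Matrix m m k) : M + M = 0 := by
  ext i j
  exact CharTwo.add_self_eq_zero _

/-- In characteristic 2, an isometry `X` of a symplectic space with `(X - 1) ^ 4 = 0` and
`(X - 1) ^ 3` of rank one satisfies `ω(e, X² e) ≠ 0` for some `e`. -/
lemma exists_sympForm_sq_ne_zero [CharP k 2] {X : Matrix (Fin n ⊕ Fin n) (Fin n ⊕ Fin n) k}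
    (hX : ∀ v w, sympForm k n (X *ᵥ v) (X *ᵥ w) = sympForm k n v w) (hX4 : X ^ 4 = 1)
    (hrank : ((X - 1) ^ 3).rank = 1) : ∃ e, sympForm k n e (X *ᵥ (X *ᵥ e)) ≠ 0 := by
  have h4 : ∀ v, X *ᵥ (X *ᵥ (X *ᵥ (X *ᵥ v))) = v := fun v => by
    simp only [Matrix.mulVec_mulVec]
    rw [show X * (X * (X * X)) = X ^ 4 by noncomm_ring, hX4, Matrix.one_mulVec]
  have hN : ∀ v, (X - 1) ^ 3 *ᵥ v = X *ᵥ (X *ᵥ (X *ᵥ v)) + X *ᵥ (X *ᵥ v) + X *ᵥ v + v := by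
    intro v
    have : (X - 1) ^ 3 = X * (X * X) + X * X + X + 1 := by
      rw [← sub_eq_zero]
      calc (X - 1) ^ 3 - (X * (X * X) + X * X + X + 1)
          = -((X * X + X * X) + (X * X + X * X)) + (X + X) - (1 + 1) := by noncomm_ring
        _ = 0 := by simp [matrix_add_self_eq_zero]
    rw [this]
    simp only [Matrix.add_mulVec, Matrix.mulVec_mulVec, Matrix.one_mulVec]
  have hsymm : ∀ e f, sympForm k n e ((X - 1) ^ 3 *ᵥ f) = sympForm k n f ((X - 1) ^ 3 *ᵥ e) := by
    intro e f
    have h1 : sympForm k n e (X *ᵥ f) = sympForm k n (X *ᵥ (X *ᵥ (X *ᵥ e))) f := by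
      rw [← hX, ← hX, ← hX, h4]
    have h2 : sympForm k n e (X *ᵥ (X *ᵥ f)) = sympForm k n (X *ᵥ (X *ᵥ e)) f := by
      rw [← hX, ← hX, h4]
    have h3 : sympForm k n e (X *ᵥ (X *ᵥ (X *ᵥ f))) = sympForm k n (X *ᵥ e) f := by
      rw [← hX, h4]
    simp only [hN, sympForm_add_right, h1, h2, h3, sympForm_swap _ f]
    ring
  obtain ⟨⟨z, hz⟩, hz0, hspan⟩ := finrank_eq_one_iff'.1 hrank
  have hφ : ∀ v, ∃ c : k, (X - 1) ^ 3 *ᵥ v = c • z := fun v => by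
    obtain ⟨c, hc⟩ := hspan ⟨(X - 1) ^ 3 *ᵥ v, v, rfl⟩
    exact ⟨c, (congrArg Subtype.val hc).symm⟩
  choose φ hφ using hφ
  have hzne : z ≠ 0 := fun h => hz0 (Subtype.ext h)
  have hdiag : ∃ e, sympForm k n e ((X - 1) ^ 3 *ᵥ e) ≠ 0 := by
    obtain ⟨e, he⟩ := hz
    rw [Matrix.mulVecLin_apply] at he
    obtain ⟨f, hf⟩ := exists_sympForm_ne_zero hzne
    have hef := hsymm f e
    rw [he, hφ f, sympForm_smul_right, sympForm_swap] at hef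
    refine ⟨f, ?_⟩
    rw [hφ f, sympForm_smul_right, sympForm_swap]
    refine mul_ne_zero (fun h0 => hf ?_) hf
    rw [hef, h0, zero_mul]
  obtain ⟨e, he⟩ := hdiag
  refine ⟨e, fun h0 => he ?_⟩
  have h3 : sympForm k n e (X *ᵥ (X *ᵥ (X *ᵥ e))) = sympForm k n e (X *ᵥ e) := by
    rw [← hX, h4, sympForm_swap]
  rw [hN, sympForm_add_right, sympForm_add_right, sympForm_add_right, h0, h3, sympForm_self,
    add_zero, add_zero, CharTwo.add_self_eq_zero]

/-- In characteristic 2, for an isometry `X` with `X ^ 4 = 1`, the quadratic forms `ω(w, X w)` and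
`ω(w, X² w)` can only be proportional when the latter vanishes. -/
lemma sympForm_sq_eq_zero_of_proportional [CharP k 2]
    {X : Matrix (Fin n ⊕ Fin n) (Fin n ⊕ Fin n) k}
    (hX : ∀ v w, sympForm k n (X *ᵥ v) (X *ᵥ w) = sympForm k n v w) (hX4 : X ^ 4 = 1) (c : k)
    (hc : ∀ w, sympForm k n w (X *ᵥ w) = c * sympForm k n w (X *ᵥ (X *ᵥ w)))
    (e : Fin n ⊕ Fin n → k) : sympForm k n e (X *ᵥ (X *ᵥ e)) = 0 := by
  have h4 : X *ᵥ (X *ᵥ (X *ᵥ (X *ᵥ e))) = e := by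
    simp only [Matrix.mulVec_mulVec]
    rw [show X * (X * (X * X)) = X ^ 4 by noncomm_ring, hX4, Matrix.one_mulVec]
  have h3 : sympForm k n e (X *ᵥ (X *ᵥ (X *ᵥ e))) = sympForm k n e (X *ᵥ e) := by
    rw [← hX, h4, sympForm_swap]
  have := hc (e + X *ᵥ e)
  simp only [Matrix.mulVec_add, sympForm_add_left, sympForm_add_right, sympForm_self, hX, h3]
    at this
  have h2 : (2 : k) = 0 := CharTwo.two_eq_zero
  linear_combination this + (-sympForm k n e (X *ᵥ e) + c * sympForm k n e (X *ᵥ e)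
    + c * sympForm k n e (X *ᵥ (X *ᵥ e))) * h2

lemma HasRegularEntries.sympForm_mem
    {A : GL (Fin n ⊕ Fin n) k → Matrix (Fin n ⊕ Fin n) (Fin n ⊕ Fin n) k}
    (hA : HasRegularEntries A) (v w : Fin n ⊕ Fin n → k) :
    (fun g => sympForm k n v (A g *ᵥ w)) ∈ regularFunctions (Fin n ⊕ Fin n) k := by
  have : (fun g => sympForm k n v (A g *ᵥ w)) = ∑ i : Fin n,
      ((fun _ => v (Sum.inl i)) * (fun g => (A g *ᵥ w) (Sum.inr i)) -
        (fun _ => v (Sum.inr i)) * (fun g => (A g *ᵥ w) (Sum.inl i))) := by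
    ext g
    simp [sympForm]
  rw [this]
  exact sum_mem fun i _ => sub_mem
    (mul_mem (const_mem_regularFunctions _) (hA.mulVec_apply_mem w _))
    (mul_mem (const_mem_regularFunctions _) (hA.mulVec_apply_mem w _))

/-- A regular function vanishing on a subset of a matrix group vanishes on its closure. -/
lemma regularFunctions_eq_zero_of_mem_closure {m : Type*} [DecidableEq m] [Fintype m]
    {G : Subgroup (GL m k)} {f : GL m k → k} (hf : f ∈ regularFunctions m k) {S : Set G}
    (hS : ∀ g ∈ S, f g = 0) {g : G} (hg : g ∈ closure S) : f g = 0 := by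
  have hclosed : IsClosed {g : G | f g = 0} := by
    have := (isOpen_ne_zero_of_mem_regularFunctions hf).preimage
      (continuous_subtype_val : Continuous (Subtype.val : G → GL m k))
    exact ⟨this⟩
  exact closure_minimal hS hclosed hg

/-- A Borel subgroup of the symplectic group over an algebraically closed field stabilises a
line. -/
lemma IsBorel.exists_common_eigenvector [IsAlgClosed k] [Nonempty (Fin n)]
    {B : Subgroup (SpGroup k n)} (hB : IsBorel (SpGroup k n) B) :
    ∃ v : Fin n ⊕ Fin n → k, v ≠ 0 ∧
      ∀ b ∈ B, ∃ c : k, (b : GL (Fin n ⊕ Fin n) k).val *ᵥ v = c • v := by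
  obtain ⟨_, hconn, hsolv, _⟩ := hB
  let H : Subgroup (GL (Fin n ⊕ Fin n) k) := B.map (SpGroup k n).subtype
  have hH : IsRegularlyConnected H := isRegularlyConnected_of_isPreconnected (by
    have := hconn.isPreconnected.image Subtype.val continuous_subtype_val.continuousOn
    simpa [H] using this)
  have : Group.IsSolvable B := hsolv
  obtain ⟨d, hd⟩ := (Group.isSolvable_of_surjective
    ((SpGroup k n).subtype.subgroupMap_surjective B) : Group.IsSolvable H).solvable
  obtain ⟨v, hv, hvH⟩ := exists_common_eigenvector_of_solvable d H hH
    (by rw [← map_subtype_derivedSeries, hd, Subgroup.map_bot])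
  exact ⟨v, hv, fun b hb => hvH _ ⟨b, hb, rfl⟩⟩

end Symplectic

/-- Let `k` be an algebraically closed field of characteristic 2 and
`n ≥ 2`. The unipotent conjugacy class with Jordan type `4 ⊕ 1^{2n-4}` in `Sp(2n, k)`
is not spherical. -/
theorem not_spherical_jordan_type_4_char_two
    (k : Type*) [Field k] [IsAlgClosed k] (hchar : ringChar k = 2)
    (n : ℕ) (hn : 2 ≤ n)
    (u : SpGroup k n) (hu : hasJordanType4 u) :
    ¬ IsSphericalClass (SpGroup k n) (conjClass u) := by
  rintro ⟨B, hB, x, _, hdense⟩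
  have : CharP k 2 := ringChar.of_eq hchar
  have : Nonempty (Fin n) := ⟨⟨0, by omega⟩⟩
  obtain ⟨v, hv, hvB⟩ := hB.exists_common_eigenvector
  obtain ⟨hN4, -, -, hN3⟩ := hu
  set X : Matrix (Fin n ⊕ Fin n) (Fin n ⊕ Fin n) k := (u : GL (Fin n ⊕ Fin n) k).val with hXdef
  have hX : ∀ v w, sympForm k n (X *ᵥ v) (X *ᵥ w) = sympForm k n v w := u.2
  have hX4 : X ^ 4 = 1 := by
    rw [← sub_eq_zero]
    calc X ^ 4 - 1 = (X - 1) ^ 4 + ((2 * X ^ 3 - 3 * X ^ 2 + 2 * X) +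
          (2 * X ^ 3 - 3 * X ^ 2 + 2 * X)) + -(1 + 1) := by noncomm_ring
      _ = 0 := by simp only [hN4, matrix_add_self_eq_zero, neg_zero]
  let F₁ : GL (Fin n ⊕ Fin n) k → k := fun g => sympForm k n v (g.val *ᵥ v)
  let F₂ : GL (Fin n ⊕ Fin n) k → k := fun g => sympForm k n v ((g.val * g.val) *ᵥ v)
  have hF₁ : F₁ ∈ regularFunctions _ k := hasRegularEntries_id.sympForm_mem v v
  have hF₂ : F₂ ∈ regularFunctions _ k :=
    (hasRegularEntries_id.mul hasRegularEntries_id).sympForm_mem v v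
  have hconj : ∀ (g y : SpGroup k n) (w : Fin n ⊕ Fin n → k),
      (g : GL (Fin n ⊕ Fin n) k).val *ᵥ w = v →
      F₁ (g * y * g⁻¹ : SpGroup k n) =
        sympForm k n w ((y : GL (Fin n ⊕ Fin n) k).val *ᵥ w) ∧
      F₂ (g * y * g⁻¹ : SpGroup k n) = sympForm k n w
        ((y : GL (Fin n ⊕ Fin n) k).val *ᵥ ((y : GL (Fin n ⊕ Fin n) k).val *ᵥ w)) := by
    rintro g y w rfl
    refine ⟨?_, ?_⟩
    · rw [← g.2 w]
      simp only [F₁, Matrix.mulVec_mulVec, ← Units.val_mul]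
      congr 3
      push_cast
      group
    · rw [← g.2 w]
      simp only [F₂, Matrix.mulVec_mulVec, ← Units.val_mul]
      congr 3
      push_cast
      group
  have horbit : ∀ y ∈ conjOrbit B x, ∃ c : k, F₁ y = c * F₁ x ∧ F₂ y = c * F₂ x := by
    rintro y ⟨b, hb, rfl⟩
    obtain ⟨c, hc⟩ := hvB _ (inv_mem hb)
    have hbv : (b : GL (Fin n ⊕ Fin n) k).val *ᵥ (c • v) = v := by
      rw [← hc, Matrix.mulVec_mulVec, ← Units.val_mul]
      simp
    obtain ⟨h₁, h₂⟩ := hconj b x _ hbv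
    refine ⟨c * c, ?_, ?_⟩
    · rw [h₁, Matrix.mulVec_smul, sympForm_smul_left, sympForm_smul_right, mul_assoc]
    · rw [h₂, Matrix.mulVec_smul, Matrix.mulVec_smul, sympForm_smul_left, sympForm_smul_right,
        Matrix.mulVec_mulVec, mul_assoc]
  have hclass : ∀ g : SpGroup k n, g * u * g⁻¹ ∈ closure (conjOrbit B x) := fun g =>
    hdense (isConj_iff.2 ⟨g, rfl⟩)
  obtain ⟨e, he⟩ := exists_sympForm_sq_ne_zero hX hX4 hN3
  have hF₂x : F₂ x ≠ 0 := by
    intro h0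
    have he0 : e ≠ 0 := by
      rintro rfl
      exact he (by simp [sympForm])
    obtain ⟨g, hg⟩ := exists_spGroup_mulVec_eq he0 hv
    refine he ((hconj g u e hg).2.symm.trans ?_)
    refine regularFunctions_eq_zero_of_mem_closure hF₂ (fun y hy => ?_) (hclass g)
    obtain ⟨c, -, hc⟩ := horbit y hy
    rw [hc, h0, mul_zero]
  refine he (sympForm_sq_eq_zero_of_proportional hX hX4 (F₁ x / F₂ x) (fun w => ?_) e)
  rcases eq_or_ne w 0 with rfl | hw
  · simp [sympForm]
  obtain ⟨g, hg⟩ := exists_spGroup_mulVec_eq hw hv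
  obtain ⟨h₁, h₂⟩ := hconj g u w hg
  have hreg : (fun g => F₁ g - F₁ x / F₂ x * F₂ g) ∈ regularFunctions (Fin n ⊕ Fin n) k :=
    sub_mem hF₁ (mul_mem (const_mem_regularFunctions _) hF₂)
  have := regularFunctions_eq_zero_of_mem_closure hreg (fun y hy => by
    obtain ⟨c, hc₁, hc₂⟩ := horbit y hy
    simp only [hc₁, hc₂]
    field_simp
    ring) (hclass g)
  rw [h₁, h₂] at this
  exact sub_eq_zero.1 this
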